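/- (Non-identifiability of (W, V) from a single profile.) Let σ > 0, κ > 0, let W, V be L-periodic and twice continuously differentiable, and let u* be twice continuously differentiable, L-periodic, strictly positive, solving the stationary equation d/dx(σ u*'(x) + κ u*(x) (W*u*)'(x) + u*(x) V'(x)) = 0 for all x ∈ ℝ. Let Q be any even, L-periodic, twice continuously differentiable kernel with ∫_Ω Q dx = 0, and define W₀ := W + Q and V₀ := V - κ (Q*u*). Then u* also solves the stationary equation with inputs (W₀, V₀): d/dx(σ u*'(x) + κ u*(x) (W₀*u*)'(x) + u*(x) V₀'(x)) = 0 for all x ∈ ℝ, and moreover ∫_Ω W₀ dx = ∫_Ω W dx. -/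

import Mathlib

open MeasureTheory Real Set

/-- Periodic convolution over Ω = (-L/2, L/2]: `(G*u)(x) = ∫_Ω G(x-y) u(y) dy`. -/
noncomputable def pconv (L : ℝ) (G u : ℝ → ℝ) (x : ℝ) : ℝ :=
  ∫ y in Set.Ioc (-(L/2)) (L/2), G (x - y) * u y

theorem integrableOn_pconv (L : ℝ) {G u : ℝ → ℝ} (hG : Continuous G) (hu : Continuous u)
    (x : ℝ) : IntegrableOn (fun y => G (x - y) * u y) (Ioc (-(L/2)) (L/2)) :=
  Continuous.integrableOn_Ioc (by fun_prop)

theorem pconv_add (L : ℝ) {G H u : ℝ → ℝ} (hG : Continuous G) (hH : Continuous H)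
    (hu : Continuous u) :
    pconv L (fun z => G z + H z) u = fun x => pconv L G u x + pconv L H u x := by
  funext x
  simp only [pconv, add_mul]
  exact integral_add (integrableOn_pconv L hG hu x) (integrableOn_pconv L hH hu x)

theorem differentiable_pconv (L : ℝ) {G u : ℝ → ℝ} (hG : ContDiff ℝ 1 G) (hu : Continuous u) :
    Differentiable ℝ (pconv L G u) := by
  intro x
  have hGc : Continuous G := hG.continuous
  have hG' : Continuous (deriv G) := hG.continuous_deriv le_rfl
  obtain ⟨C, hC⟩ := ((isCompact_closedBall x 1).prod
    (isCompact_Icc (a := -(L/2)) (b := L/2))).exists_bound_of_continuousOn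
    (f := fun p : ℝ × ℝ => deriv G (p.1 - p.2) * u p.2) (by fun_prop)
  refine (hasDerivAt_integral_of_dominated_loc_of_deriv_le
    (μ := volume.restrict (Ioc (-(L/2)) (L/2)))
    (F := fun x y => G (x - y) * u y) (F' := fun x y => deriv G (x - y) * u y)
    (bound := fun _ => C) (Metric.closedBall_mem_nhds x one_pos)
    (Filter.Eventually.of_forall fun z => (integrableOn_pconv L hGc hu z).aestronglyMeasurable)
    (integrableOn_pconv L hGc hu x)
    (integrableOn_pconv L hG' hu x).aestronglyMeasurable
    ?_ (integrable_const C) ?_).2.differentiableAt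
  · filter_upwards [ae_restrict_mem measurableSet_Ioc] with y hy z hz
    exact hC (z, y) ⟨hz, Ioc_subset_Icc_self hy⟩
  · refine Filter.Eventually.of_forall fun y z _ => ?_
    have hd : HasDerivAt G (deriv G (z - y)) (z - y) :=
      (hG.differentiable one_ne_zero _).hasDerivAt
    exact (hd.comp_sub_const z y).mul_const (u y)

/-- Non-identifiability of `(W, V)` from a single profile: if `u*` solves
the stationary equation with inputs `(W, V)`, and `Q` is any even, L-periodic, C² kernel
of zero mass, then `u*` also solves the stationary equation with inputs
`(W₀, V₀) = (W + Q, V - κ (Q*u*))`, and `∫_Ω W₀ = ∫_Ω W`. -/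
theorem pair_nonidentifiable (L σ κ : ℝ) (hL : 0 < L) (hσ : 0 < σ) (hκ : 0 < κ)
    (W V : ℝ → ℝ) (hW : ContDiff ℝ 2 W) (hWper : Function.Periodic W L)
    (hV : ContDiff ℝ 2 V) (hVper : Function.Periodic V L)
    (ustar : ℝ → ℝ) (hu : ContDiff ℝ 2 ustar) (huper : Function.Periodic ustar L)
    (hupos : ∀ x : ℝ, 0 < ustar x)
    (hstat : ∀ x : ℝ,
      deriv (fun y => σ * deriv ustar y + κ * ustar y * deriv (pconv L W ustar) y
        + ustar y * deriv V y) x = 0)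
    (Q : ℝ → ℝ) (hQ : ContDiff ℝ 2 Q) (hQper : Function.Periodic Q L)
    (hQeven : ∀ x : ℝ, Q (-x) = Q x)
    (hQmass : (∫ x in Set.Ioc (-(L/2)) (L/2), Q x) = 0) :
    (∀ x : ℝ,
      deriv (fun y => σ * deriv ustar y
        + κ * ustar y * deriv (pconv L (fun z => W z + Q z) ustar) y
        + ustar y * deriv (fun z => V z - κ * pconv L Q ustar z) y) x = 0) ∧
    (∫ x in Set.Ioc (-(L/2)) (L/2), (W x + Q x)) = ∫ x in Set.Ioc (-(L/2)) (L/2), W x := by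
  have hW1 : ContDiff ℝ 1 W := hW.of_le one_le_two
  have hQ1 : ContDiff ℝ 1 Q := hQ.of_le one_le_two
  have hdW := differentiable_pconv L hW1 hu.continuous
  have hdQ := differentiable_pconv L hQ1 hu.continuous
  have hdV : Differentiable ℝ V := hV.differentiable two_ne_zero
  refine ⟨fun x => ?_, ?_⟩
  · rw [← hstat x]
    congr 1
    funext y
    rw [pconv_add L hW.continuous hQ.continuous hu.continuous,
      deriv_fun_add (hdW y) (hdQ y), deriv_fun_sub (hdV y) ((hdQ y).const_mul κ),
      deriv_const_mul κ (hdQ y)]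
    ring
  · rw [integral_add hW.continuous.integrableOn_Ioc hQ.continuous.integrableOn_Ioc, hQmass,
      add_zero]
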